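/- arXiv:1205.5913 — 3 statements merged into one kernel-verified Lean document; each statement's English description precedes it below -/
import Mathlib

section
/- Every connected bipartite δ-regular simple graph with exactly 4 distinct adjacency eigenvalues and diameter 3 is distance-regular. -/
open Finset Polynomial

/-- A connected graph with diameter `D` is distance-regular if for every `i ≤ D` there are
constants `c i`, `a i`, `b i` such that every vertex `v` at distance `i` from a vertex `u`
has exactly `c i` neighbors at distance `i - 1` from `u`, exactly `a i` neighbors at
distance `i` from `u`, and exactly `b i` neighbors at distance `i + 1` from `u`. -/
def IsDistanceRegular {V : Type*} [Fintype V] [DecidableEq V]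
    (G : SimpleGraph V) [DecidableRel G.Adj] (D : ℕ) : Prop :=
  ∀ i : ℕ, i ≤ D → ∃ c a b : ℕ, ∀ u v : V, G.dist u v = i →
    ((G.neighborFinset v).filter (fun w => G.dist u w + 1 = i)).card = c ∧
    ((G.neighborFinset v).filter (fun w => G.dist u w = i)).card = a ∧
    ((G.neighborFinset v).filter (fun w => G.dist u w = i + 1)).card = b

/-- Four distinct reals closed under negation have, besides any given one among their squares,
only one further square. -/
lemma exists_sq_eq_or_sq_eq {θ : Fin 4 → ℝ} (hθ : StrictAnti θ)
    (hneg : ∀ x ∈ Set.range θ, -x ∈ Set.range θ) {d : ℝ} (hd : d ∈ Set.range θ) :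
    ∃ t : ℝ, ∀ x ∈ Set.range θ, x ^ 2 = d ^ 2 ∨ x ^ 2 = t := by
  have hrev : (fun i => -θ i) = fun i => θ (Fin.rev i) := by
    refine (StrictMono.range_inj (fun i j h => neg_lt_neg (hθ h))
      (fun i j h => hθ (Fin.rev_lt_rev.2 h))).1 (Set.ext fun x => ⟨?_, ?_⟩)
    · rintro ⟨i, rfl⟩
      obtain ⟨j, hj⟩ := hneg _ ⟨i, rfl⟩
      exact ⟨Fin.rev j, by simpa using hj⟩
    · rintro ⟨i, rfl⟩
      obtain ⟨j, hj⟩ := hneg _ ⟨Fin.rev i, rfl⟩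
      exact ⟨j, by simp [hj]⟩
  have h3 : θ 3 = -θ 0 := (congrFun hrev 0).symm
  have h2 : θ 2 = -θ 1 := (congrFun hrev 1).symm
  obtain ⟨k, rfl⟩ := hd
  simp only [Set.forall_mem_range, Fin.forall_fin_succ]
  fin_cases k
  · exact ⟨θ 1 ^ 2, by simp [h2, h3]⟩
  · exact ⟨θ 0 ^ 2, by simp [h2, h3]⟩
  · exact ⟨θ 0 ^ 2, by simp [h2, h3]⟩
  · exact ⟨θ 1 ^ 2, by simp [h2, h3]⟩

namespace SimpleGraph

variable {V : Type*} {G : SimpleGraph V}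

lemma Walk.even_length_iff_of_coloring {f : V → Bool} (hf : ∀ u v, G.Adj u v → f u ≠ f v)
    {u v : V} (p : G.Walk u v) : Even p.length ↔ f u = f v := by
  induction p with
  | nil => simp
  | @cons u v w h p ih =>
    have := hf _ _ h
    rw [Walk.length_cons, Nat.even_add_one, ih]
    cases hu : f u <;> cases hv : f v <;> cases hw : f w <;> simp_all

lemma Connected.even_dist_iff_of_coloring (hconn : G.Connected) {f : V → Bool}
    (hf : ∀ u v, G.Adj u v → f u ≠ f v) (u v : V) : Even (G.dist u v) ↔ f u = f v := by
  obtain ⟨p, hp⟩ := hconn.exists_walk_length_eq_dist u v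
  rw [← hp, p.even_length_iff_of_coloring hf]

lemma Connected.dist_eq_or_of_adj_of_coloring (hconn : G.Connected) {f : V → Bool}
    (hf : ∀ u v, G.Adj u v → f u ≠ f v) (u : V) {v w : V} (h : G.Adj v w) :
    G.dist u w + 1 = G.dist u v ∨ G.dist u w = G.dist u v + 1 := by
  have hne : G.dist u w ≠ G.dist u v := by
    intro he
    have h1 := hconn.even_dist_iff_of_coloring hf u v
    have h2 := hconn.even_dist_iff_of_coloring hf u w
    have h3 := hf _ _ h
    rw [he, h1] at h2
    cases hu : f u <;> cases hv : f v <;> cases hw : f w <;> simp_all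
  have h1 := hconn.dist_triangle (u := u) (v := v) (w := w)
  have h2 := hconn.dist_triangle (u := u) (v := w) (w := v)
  rw [dist_eq_one_iff_adj.2 h] at h1
  rw [dist_eq_one_iff_adj.2 h.symm] at h2
  omega

lemma isSelfAdjoint_adjMatrix [DecidableRel G.Adj] : IsSelfAdjoint (G.adjMatrix ℝ) := by
  rw [IsSelfAdjoint, Matrix.star_eq_conjTranspose, Matrix.conjTranspose_eq_transpose_of_trivial,
    transpose_adjMatrix]

variable [Fintype V] [DecidableEq V] [DecidableRel G.Adj]

/-- In a bipartite regular graph the numbers `a i` vanish and `b i` is determined by `c i`. -/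
lemma Connected.isDistanceRegular_of_coloring (hconn : G.Connected) {δ : ℕ}
    (hreg : G.IsRegularOfDegree δ) {f : V → Bool} (hf : ∀ u v, G.Adj u v → f u ≠ f v) {D : ℕ}
    (hc : ∀ i ≤ D, ∃ c : ℕ, ∀ u v : V, G.dist u v = i →
      ((G.neighborFinset v).filter (fun w => G.dist u w + 1 = i)).card = c) :
    IsDistanceRegular G D := by
  intro i hi
  obtain ⟨c, hc⟩ := hc i hi
  refine ⟨c, 0, δ - c, fun u v huv => ⟨hc u v huv, ?_, ?_⟩⟩
  · rw [card_eq_zero, filter_eq_empty_iff]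
    intro w hw
    have := hconn.dist_eq_or_of_adj_of_coloring hf u ((G.mem_neighborFinset v w).1 hw)
    omega
  · have hb : (G.neighborFinset v).filter (fun w => G.dist u w = i + 1) =
        (G.neighborFinset v).filter (fun w => ¬ G.dist u w + 1 = i) := by
      refine filter_congr fun w hw => ?_
      have := hconn.dist_eq_or_of_adj_of_coloring hf u ((G.mem_neighborFinset v w).1 hw)
      omega
    have := card_filter_add_card_filter_not (s := G.neighborFinset v)
      (fun w => G.dist u w + 1 = i)
    rw [card_neighborFinset_eq_degree, hreg v, hc u v huv] at this
    rw [hb]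
    omega

lemma adjMatrix_sq_apply_eq_card (u v : V) :
    (G.adjMatrix ℝ ^ 2) u v =
      ((G.neighborFinset v).filter (fun w => G.dist u w + 1 = 2)).card := by
  rw [sq, mul_adjMatrix_apply]
  simp [adjMatrix_apply, Finset.sum_boole, dist_eq_one_iff_adj]

lemma aeval_adjMatrix_eq_zero {p : ℝ[X]} (hp : ∀ x ∈ spectrum ℝ (G.adjMatrix ℝ), p.eval x = 0) :
    aeval (G.adjMatrix ℝ) p = 0 := by
  rw [← cfc_polynomial p (G.adjMatrix ℝ) isSelfAdjoint_adjMatrix, cfc_congr hp,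
    cfc_const_zero]

lemma IsRegularOfDegree.natCast_mem_spectrum_adjMatrix [Nonempty V] {δ : ℕ}
    (hreg : G.IsRegularOfDegree δ) : (δ : ℝ) ∈ spectrum ℝ (G.adjMatrix ℝ) := by
  rw [spectrum.mem_iff, Matrix.isUnit_iff_isUnit_det, isUnit_iff_ne_zero, not_not,
    ← Matrix.exists_mulVec_eq_zero_iff]
  refine ⟨Function.const V 1, ?_, ?_⟩
  · intro h
    simpa using congrFun h (Classical.arbitrary V)
  · ext v
    rw [Matrix.sub_mulVec, Pi.sub_apply, adjMatrix_mulVec_const_apply_of_regular hreg,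
      Algebra.algebraMap_eq_smul_one, Matrix.smul_mulVec, Matrix.one_mulVec]
    simp

/-- The diagonal matrix of signs of a two-coloring. -/
def colorSign (f : V → Bool) : Matrix V V ℝ := Matrix.diagonal fun v => if f v then 1 else -1

lemma colorSign_mul_self (f : V → Bool) : colorSign f * colorSign f = 1 := by
  rw [colorSign, Matrix.diagonal_mul_diagonal, ← Matrix.diagonal_one]
  congr 1
  ext v
  cases f v <;> simp

lemma colorSign_mul_adjMatrix {f : V → Bool} (hf : ∀ u v, G.Adj u v → f u ≠ f v) :
    colorSign f * G.adjMatrix ℝ = - G.adjMatrix ℝ * colorSign f := by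
  ext u v
  rw [colorSign, Matrix.diagonal_mul, Matrix.mul_diagonal, Matrix.neg_apply, adjMatrix_apply]
  by_cases h : G.Adj u v
  · have := hf u v h
    cases hu : f u <;> cases hv : f v <;> simp_all
  · simp [h]

lemma adjMatrix_pow_three_apply_of_coloring_eq {f : V → Bool}
    (hf : ∀ u v, G.Adj u v → f u ≠ f v) {u v : V} (huv : f u = f v) :
    (G.adjMatrix ℝ ^ 3) u v = 0 := by
  have h := colorSign_mul_adjMatrix hf
  have h3 : colorSign f * G.adjMatrix ℝ ^ 3 = - G.adjMatrix ℝ ^ 3 * colorSign f := by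
    have := (show SemiconjBy (colorSign f) (G.adjMatrix ℝ) (-G.adjMatrix ℝ) from h).pow_right 3
    rw [SemiconjBy, Odd.neg_pow (by decide)] at this
    exact this
  have := congrFun (congrFun h3 u) v
  rw [colorSign, Matrix.diagonal_mul, Matrix.mul_diagonal, Matrix.neg_apply, huv] at this
  split_ifs at this <;> linarith

lemma neg_mem_spectrum_adjMatrix_of_coloring {f : V → Bool}
    (hf : ∀ u v, G.Adj u v → f u ≠ f v) {x : ℝ} (hx : x ∈ spectrum ℝ (G.adjMatrix ℝ)) :
    -x ∈ spectrum ℝ (G.adjMatrix ℝ) := by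
  let S : (Matrix V V ℝ)ˣ :=
    ⟨colorSign f, colorSign f, colorSign_mul_self f, colorSign_mul_self f⟩
  have h : (S : Matrix V V ℝ) * G.adjMatrix ℝ * (S⁻¹ : (Matrix V V ℝ)ˣ) = - G.adjMatrix ℝ := by
    change colorSign f * G.adjMatrix ℝ * colorSign f = _
    rw [colorSign_mul_adjMatrix hf, mul_assoc, colorSign_mul_self, mul_one]
  have := spectrum.units_conjugate (R := ℝ) (a := G.adjMatrix ℝ) (u := S)
  rw [h, ← spectrum.neg_eq] at this
  rw [← this] at hx
  exact hx

/-- In a connected regular graph, a matrix whose columns are eigenvectors for the valency has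
constant columns. -/
lemma Connected.apply_eq_of_adjMatrix_mul_eq (hconn : G.Connected) {δ : ℕ}
    (hreg : G.IsRegularOfDegree δ) {M : Matrix V V ℝ} (hM : G.adjMatrix ℝ * M = (δ : ℝ) • M)
    (u v w : V) : M u w = M v w := by
  refine (G.lapMatrix_mulVec_eq_zero_iff_forall_reachable (x := fun i => M i w)).1 ?_ u v
    (hconn.preconnected u v)
  ext i
  have := congrFun (congrFun hM i) w
  rw [Matrix.mul_apply, Matrix.smul_apply, smul_eq_mul] at this
  rw [lapMatrix, Matrix.sub_mulVec, Pi.sub_apply, degMatrix, Matrix.mulVec_diagonal, hreg i,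
    Matrix.mulVec, dotProduct, this]
  simp

/-- If the eigenvalues of a connected bipartite regular graph have at most one square besides that
of the valency, then any two vertices at distance two have the same number of common neighbors. -/
lemma Connected.exists_adjMatrix_sq_apply_eq (hconn : G.Connected) {δ : ℕ} (hδ : δ ≠ 0)
    (hreg : G.IsRegularOfDegree δ) {f : V → Bool} (hf : ∀ u v, G.Adj u v → f u ≠ f v) {t : ℝ}
    (ht : ∀ x ∈ spectrum ℝ (G.adjMatrix ℝ), x ^ 2 = (δ : ℝ) ^ 2 ∨ x ^ 2 = t) :
    ∃ c : ℝ, ∀ u v, u ≠ v → f u = f v → (G.adjMatrix ℝ ^ 2) u v = c := by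
  have := hconn.nonempty
  set A := G.adjMatrix ℝ with hA
  have hp : aeval A ((X ^ 2 - C ((δ : ℝ) ^ 2)) * (X ^ 2 - C t)) = 0 := by
    refine aeval_adjMatrix_eq_zero fun x hx => ?_
    rcases ht x hx with h | h <;> simp [h]
  set M : Matrix V V ℝ := A ^ 3 + (δ : ℝ) • A ^ 2 - t • A - ((δ : ℝ) * t) • 1 with hM
  have hAM : A * M = (δ : ℝ) • M := by
    simp only [map_mul, map_sub, map_pow, aeval_X, aeval_C, Algebra.algebraMap_eq_smul_one,
      _root_.smul_pow, one_pow] at hp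
    rw [← sub_eq_zero, ← hp, hM]
    simp only [mul_sub, sub_mul, mul_add, smul_sub, smul_add, mul_smul_comm, smul_mul_assoc,
      smul_smul, mul_one, one_mul, ← pow_succ', ← pow_mul, ← sq, Nat.reduceAdd]
    module
  have hMt (u v : V) : M u v = M v u := by
    have hAt : A.transpose = A := transpose_adjMatrix ..
    have : M.transpose = M := by
      simp [hM, Matrix.transpose_pow, hAt]
    exact congrFun (congrFun this v) u
  have hcol := hconn.apply_eq_of_adjMatrix_mul_eq hreg hAM
  let o : V := Classical.arbitrary V
  refine ⟨M o o / δ, fun u v huv hfuv => ?_⟩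
  have h1 : M u v = M o o := by rw [hcol u o v, hMt, hcol v o o]
  have hδ' : (δ : ℝ) ≠ 0 := Nat.cast_ne_zero.2 hδ
  have h3 : (A ^ 3) u v = 0 := adjMatrix_pow_three_apply_of_coloring_eq hf hfuv
  have h0 : A u v = 0 := by
    rw [hA, adjMatrix_apply, if_neg fun h => hf _ _ h hfuv]
  rw [← h1, eq_div_iff hδ', hM]
  simp [h3, h0, huv, mul_comm]

end SimpleGraph

/-- Every connected bipartite `δ`-regular graph with exactly 4 distinct
adjacency eigenvalues and diameter 3 is distance-regular. -/
theorem bipartite_fourEigenvalues_diamThree_distRegular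
    {V : Type*} [Fintype V] [DecidableEq V]
    (G : SimpleGraph V) [DecidableRel G.Adj] (hconn : G.Connected)
    (δ : ℕ) (hreg : G.IsRegularOfDegree δ)
    (hbip : ∃ f : V → Bool, ∀ u v : V, G.Adj u v → f u ≠ f v)
    (θ : Fin 4 → ℝ) (hθ : StrictAnti θ)
    (hspec : spectrum ℝ (G.adjMatrix ℝ) = Set.range θ)
    (hdiam : (∀ u v : V, G.dist u v ≤ 3) ∧ ∃ u v : V, G.dist u v = 3) :
    IsDistanceRegular G 3 := by
  obtain ⟨f, hf⟩ := hbip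
  have := hconn.nonempty
  obtain ⟨hle, u₀, v₀, h₀⟩ := hdiam
  have hδ : δ ≠ 0 := by
    have : Nontrivial V := ⟨u₀, v₀, by rintro rfl; simp at h₀⟩
    rw [← hreg u₀]
    exact (hconn.preconnected.degree_pos_of_nontrivial u₀).ne'
  obtain ⟨t, ht⟩ := exists_sq_eq_or_sq_eq hθ
    (fun x hx => hspec ▸ SimpleGraph.neg_mem_spectrum_adjMatrix_of_coloring hf (hspec ▸ hx))
    (hspec ▸ hreg.natCast_mem_spectrum_adjMatrix)
  obtain ⟨c, hc⟩ := hconn.exists_adjMatrix_sq_apply_eq hδ hreg hf (t := t) (hspec ▸ ht)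
  refine hconn.isDistanceRegular_of_coloring hreg hf fun i hi => ?_
  interval_cases i
  · exact ⟨0, fun u v _ => by simp⟩
  · refine ⟨1, fun u v huv => card_eq_one.2 ⟨u, ?_⟩⟩
    ext w
    have hadj : G.Adj v u := (SimpleGraph.dist_eq_one_iff_adj.1 huv).symm
    simp only [mem_filter, SimpleGraph.mem_neighborFinset, mem_singleton, Nat.add_eq_right,
      hconn.dist_eq_zero_iff]
    exact ⟨fun h => h.2.symm, fun h => ⟨h ▸ hadj, h.symm⟩⟩
  · refine ⟨⌊c⌋₊, fun u v huv => ?_⟩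
    have hne : u ≠ v := by rintro rfl; simp at huv
    have hfuv : f u = f v := (hconn.even_dist_iff_of_coloring hf u v).1 (by rw [huv]; decide)
    rw [← hc u v hne hfuv, SimpleGraph.adjMatrix_sq_apply_eq_card, Nat.floor_natCast]
  · refine ⟨δ, fun u v huv => ?_⟩
    rw [filter_true_of_mem, SimpleGraph.card_neighborFinset_eq_degree, hreg v]
    intro w hw
    have := hconn.dist_eq_or_of_adj_of_coloring hf u ((G.mem_neighborFinset v w).1 hw)
    have := hle u w
    omega
end

section
/- Let Γ be a connected δ-regular bipartite simple graph on n vertices with parts V₁, V₂, adjacency matrix A, distinct adjacency eigenvalues θ₀ > θ₁ > ⋯ > θ_d, and preHoffman polynomial H (which, since Γ is regular, satisfies H(A) = J, the all-ones matrix). Let H₀(x) = (H(x) + H(−x))/2 and H₁(x) = (H(x) − H(−x))/2 be the even and odd parts of H. Then (H₀(A))_{uv} = 1 if u and v lie in the same part and = 0 otherwise, and (H₁(A))_{uv} = 1 if u and v lie in different parts and = 0 otherwise. -/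
open Finset Polynomial

namespace Polynomial

/-- A real polynomial vanishing on the spectrum of a Hermitian matrix annihilates the matrix. -/
theorem aeval_eq_zero_of_isHermitian {V : Type*} [Fintype V] [DecidableEq V]
    {A : Matrix V V ℝ} (hA : A.IsHermitian) (p : ℝ[X])
    (hp : ∀ x ∈ spectrum ℝ A, p.eval x = 0) : aeval A p = 0 := by
  have hA' : IsSelfAdjoint A := hA
  rw [← cfc_polynomial p A hA', cfc_congr (g := fun _ => 0) fun x hx => hp x hx, cfc_const_zero]

/-- A real polynomial in a symmetric matrix is symmetric. -/
theorem isSymm_aeval {V : Type*} [Fintype V] [DecidableEq V]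
    {A : Matrix V V ℝ} (hA : A.IsSymm) (p : ℝ[X]) : (aeval A p).IsSymm := by
  induction p using Polynomial.induction_on' with
  | add p q hp hq => rw [map_add]; exact hp.add hq
  | monomial n a =>
    rw [aeval_monomial, ← Algebra.smul_def]
    exact (hA.pow n).smul a

/-- If `A *ᵥ x = a • x` then `p(A) *ᵥ x = p(a) • x`. -/
theorem aeval_mulVec_of_mulVec_eq_smul {V : Type*} [Fintype V] [DecidableEq V]
    {A : Matrix V V ℝ} {x : V → ℝ} {a : ℝ} (h : A.mulVec x = a • x) (p : ℝ[X]) :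
    (aeval A p).mulVec x = p.eval a • x := by
  have hpow : ∀ n : ℕ, (A ^ n).mulVec x = a ^ n • x := by
    intro n
    induction n with
    | zero => simp
    | succ n ih => rw [pow_succ, ← Matrix.mulVec_mulVec, h, Matrix.mulVec_smul, ih, smul_smul,
        pow_succ, mul_comm]
  induction p using Polynomial.induction_on' with
  | add p q hp hq => rw [map_add, Matrix.add_mulVec, hp, hq, eval_add, add_smul]
  | monomial n b =>
    rw [aeval_monomial, ← Algebra.smul_def, Matrix.smul_mulVec, hpow, eval_monomial, smul_smul]

/-- If conjugation by the sign matrix `diag s` negates `A`, then it sends `p(A)` to `p(-A)`. -/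
theorem aeval_neg_apply_of_sign {V : Type*} [Fintype V] [DecidableEq V]
    {A : Matrix V V ℝ} {s : V → ℝ} (hs : ∀ v, s v * s v = 1)
    (hA : ∀ u v, -A u v = s u * A u v * s v) (p : ℝ[X]) (u v : V) :
    (aeval (-A) p) u v = s u * (aeval A p) u v * s v := by
  have hpow : ∀ (n : ℕ) (u v : V), ((-A) ^ n) u v = s u * (A ^ n) u v * s v := by
    intro n
    induction n with
    | zero =>
      intro u v
      by_cases h : u = v
      · subst h; simp [hs]
      · simp [h]
    | succ n ih =>
      intro u v
      rw [pow_succ, pow_succ, Matrix.mul_apply, Matrix.mul_apply, Finset.mul_sum, Finset.sum_mul]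
      refine Finset.sum_congr rfl fun w _ => ?_
      rw [ih, Matrix.neg_apply, hA]
      linear_combination (s u * (A ^ n) u w * A w v * s v) * hs w
  induction p using Polynomial.induction_on' with
  | add p q hp hq => rw [map_add, map_add, Matrix.add_apply, Matrix.add_apply, hp, hq]; ring
  | monomial n b =>
    rw [aeval_monomial, aeval_monomial, ← Algebra.smul_def, ← Algebra.smul_def,
      Matrix.smul_apply, Matrix.smul_apply, hpow, smul_eq_mul, smul_eq_mul]
    ring

end Polynomial

namespace SimpleGraph

variable {V : Type*} [Fintype V] {G : SimpleGraph V} [DecidableRel G.Adj] {δ : ℕ}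

theorem IsRegularOfDegree.adjMatrix_mulVec_one (hreg : G.IsRegularOfDegree δ) :
    (G.adjMatrix ℝ).mulVec 1 = (δ : ℝ) • 1 := by
  ext v
  simp [adjMatrix_mulVec_apply, hreg.degree_eq]

variable [DecidableEq V]

theorem IsRegularOfDegree.lapMatrix_eq (hreg : G.IsRegularOfDegree δ) :
    G.lapMatrix ℝ = algebraMap ℝ (Matrix V V ℝ) δ - G.adjMatrix ℝ := by
  simp only [lapMatrix, degMatrix, hreg.degree_eq, Matrix.algebraMap_eq_diagonal]
  rfl

theorem IsRegularOfDegree.mem_spectrum_adjMatrix [Nonempty V] (hreg : G.IsRegularOfDegree δ) :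
    (δ : ℝ) ∈ spectrum ℝ (G.adjMatrix ℝ) := by
  rw [← Matrix.spectrum_toLin']
  refine Module.End.HasEigenvalue.mem_spectrum
    (Module.End.hasEigenvalue_of_hasEigenvector (x := 1) ⟨?_, one_ne_zero⟩)
  rw [Module.End.mem_eigenspace_iff, Matrix.toLin'_apply, hreg.adjMatrix_mulVec_one]

theorem IsRegularOfDegree.le_of_mem_spectrum_adjMatrix (hreg : G.IsRegularOfDegree δ) {x : ℝ}
    (hx : x ∈ spectrum ℝ (G.adjMatrix ℝ)) : x ≤ δ := by
  rw [← Matrix.spectrum_toLin', ← Module.End.hasEigenvalue_iff_mem_spectrum] at hx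
  obtain ⟨y, hy⟩ := hx.exists_hasEigenvector
  have hAy : (G.adjMatrix ℝ).mulVec y = x • y := by
    simpa only [Matrix.toLin'_apply] using hy.apply_eq_smul
  have hnn := (G.posSemidef_lapMatrix ℝ).re_dotProduct_nonneg y
  have hpos : 0 < y ⬝ᵥ y := by
    simpa using Matrix.dotProduct_star_self_pos_iff.mpr hy.2
  rw [hreg.lapMatrix_eq, Matrix.sub_mulVec, hAy, Algebra.algebraMap_eq_smul_one,
    Matrix.smul_mulVec, Matrix.one_mulVec, ← sub_smul, dotProduct_smul] at hnn
  have hmul : 0 ≤ ((δ : ℝ) - x) * (y ⬝ᵥ y) := by simpa using hnn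
  exact sub_nonneg.mp (nonneg_of_mul_nonneg_left hmul hpos)

/-- **Hoffman's theorem**: in a connected `δ`-regular graph, a polynomial with value `n` at `δ`
and vanishing at the other eigenvalues sends the adjacency matrix to the all-ones matrix. -/
theorem IsRegularOfDegree.aeval_adjMatrix_apply_eq_one (hreg : G.IsRegularOfDegree δ)
    (hconn : G.Connected) (H : ℝ[X]) (hδ : H.eval (δ : ℝ) = Fintype.card V)
    (hH : ∀ x ∈ spectrum ℝ (G.adjMatrix ℝ), x ≠ δ → H.eval x = 0) (u v : V) :
    (aeval (G.adjMatrix ℝ) H) u v = 1 := by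
  set M := aeval (G.adjMatrix ℝ) H with hM
  have hLM : G.lapMatrix ℝ * M = 0 := by
    have h := aeval_eq_zero_of_isHermitian (G.isHermitian_adjMatrix ℝ) ((C (δ : ℝ) - X) * H) <| by
      intro x hx
      by_cases hxδ : x = δ
      · simp [hxδ]
      · simp [hH x hx hxδ]
    rwa [map_mul, map_sub, aeval_C, aeval_X, ← hreg.lapMatrix_eq] at h
  have hcol : ∀ i j k : V, M i k = M j k := by
    intro i j k
    refine (G.lapMatrix_mulVec_eq_zero_iff_forall_reachable (x := fun i => M i k)).mp ?_ i j
      (hconn.preconnected i j)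
    ext i
    exact congrFun (congrFun hLM i) k
  have hsymm : M.IsSymm := isSymm_aeval G.isSymm_adjMatrix H
  have hconst : ∀ w : V, M u w = M u v := fun w => by
    rw [hcol u v w, hsymm.apply w v, hcol w u v]
  have hsum := congrFun (aeval_mulVec_of_mulVec_eq_smul hreg.adjMatrix_mulVec_one H) u
  rw [← hM, hδ] at hsum
  have hcard : (Fintype.card V : ℝ) ≠ 0 := by
    have : Nonempty V := ⟨u⟩
    exact_mod_cast Fintype.card_ne_zero
  have hmul : (Fintype.card V : ℝ) * M u v = Fintype.card V := by
    simpa [Matrix.mulVec, dotProduct, hconst] using hsum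
  exact mul_left_cancel₀ hcard (by rw [hmul, mul_one])

end SimpleGraph

/-- In a connected `δ`-regular bipartite graph on `n` vertices with parts
`V1`, `V2`, distinct eigenvalues `θ 0 > ⋯ > θ d`, and preHoffman polynomial `H` with even
part `H0` and odd part `H1`, the matrix `H0(A)` has entries `1` within the parts and `0`
between them, while `H1(A)` has entries `1` between the parts and `0` within them. -/
theorem bipartite_evenOddParts_Hoffman
    {V : Type*} [Fintype V] [DecidableEq V]
    (G : SimpleGraph V) [DecidableRel G.Adj] (hconn : G.Connected)
    (δ : ℕ) (hreg : G.IsRegularOfDegree δ)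
    (V1 V2 : Finset V) (hV1 : V1.Nonempty) (hV2 : V2.Nonempty)
    (hpart : ∀ v, v ∈ V1 ↔ v ∉ V2)
    (hbip : ∀ u v, G.Adj u v → ((u ∈ V1 ∧ v ∈ V2) ∨ (u ∈ V2 ∧ v ∈ V1)))
    (d : ℕ) (θ : Fin (d + 1) → ℝ) (hθ : StrictAnti θ)
    (hspec : spectrum ℝ (G.adjMatrix ℝ) = Set.range θ)
    (H : ℝ[X]) (hHdeg : H.degree ≤ (d : ℕ))
    (hH0val : H.eval (θ 0) = (Fintype.card V : ℝ))
    (hHival : ∀ i : Fin (d + 1), i ≠ 0 → H.eval (θ i) = 0)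
    (H0 H1 : ℝ[X])
    (hH0 : H0 = Polynomial.C (1 / 2 : ℝ) * (H + H.comp (-Polynomial.X)))
    (hH1 : H1 = Polynomial.C (1 / 2 : ℝ) * (H - H.comp (-Polynomial.X))) :
    (∀ u v : V, (Polynomial.aeval (G.adjMatrix ℝ) H0) u v =
        if (u ∈ V1 ↔ v ∈ V1) then 1 else 0) ∧
    (∀ u v : V, (Polynomial.aeval (G.adjMatrix ℝ) H1) u v =
        if (u ∈ V1 ↔ v ∈ V1) then 0 else 1) := by
  have : Nonempty V := hconn.nonempty
  obtain ⟨j, hj⟩ : (δ : ℝ) ∈ Set.range θ := hspec ▸ hreg.mem_spectrum_adjMatrix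
  have hθ0 : θ 0 = δ := le_antisymm
    (hreg.le_of_mem_spectrum_adjMatrix (hspec ▸ Set.mem_range_self 0))
    (hj ▸ hθ.antitone (Fin.zero_le j))
  have hJ : ∀ u v, (aeval (G.adjMatrix ℝ) H) u v = 1 := by
    refine hreg.aeval_adjMatrix_apply_eq_one hconn H (hθ0 ▸ hH0val) ?_
    intro x hx hxδ
    rw [hspec] at hx
    obtain ⟨i, rfl⟩ := hx
    exact hHival i fun hi => hxδ (hi ▸ hθ0)
  have hneg : ∀ u v, (aeval (-G.adjMatrix ℝ) H) u v = if (u ∈ V1 ↔ v ∈ V1) then 1 else -1 := by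
    intro u v
    rw [aeval_neg_apply_of_sign (s := fun v => if v ∈ V1 then 1 else -1), hJ]
    · by_cases hu : u ∈ V1 <;> by_cases hv : v ∈ V1 <;> simp [hu, hv]
    · intro v
      split_ifs <;> norm_num
    · intro u v
      by_cases huv : G.Adj u v
      · have hu := hpart u
        have hv := hpart v
        rcases hbip u v huv with ⟨h1, h2⟩ | ⟨h1, h2⟩
        · have : v ∉ V1 := fun h => hv.mp h h2
          simp [huv, h1, this]
        · have : u ∉ V1 := fun h => hu.mp h h1
          simp [huv, h2, this]
      · simp [huv]
  subst hH0 hH1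
  constructor <;> intro u v
  · rw [map_mul, aeval_C, ← Algebra.smul_def, map_add, aeval_comp, map_neg, aeval_X,
      Matrix.smul_apply, Matrix.add_apply, hJ, hneg]
    split_ifs <;> norm_num
  · rw [map_mul, aeval_C, ← Algebra.smul_def, map_sub, aeval_comp, map_neg, aeval_X,
      Matrix.smul_apply, Matrix.sub_apply, hJ, hneg]
    split_ifs <;> norm_num
end

section
/- Let Γ be a connected δ-regular simple graph on n vertices with d + 1 distinct adjacency eigenvalues θ₀ = δ > θ₁ > ⋯ > θ_d and diameter equal to d. Then for every pair of vertices u, v with dist(u,v) = d, the number of walks of length d from u to v satisfies (A^d)_{uv} = π₀/n, where π₀ = ∏_{i=1}^{d} (δ − θ_i). -/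
open Finset Polynomial

theorem Matrix.IsHermitian.aeval_eq_zero_of_forall_mem_spectrum
    {V : Type*} [Fintype V] [DecidableEq V] {A : Matrix V V ℝ} (hA : A.IsHermitian)
    (p : ℝ[X]) (hp : ∀ x ∈ spectrum ℝ A, p.eval x = 0) : aeval A p = 0 := by
  have hA' : IsSelfAdjoint A := hA
  rw [← cfc_polynomial p A hA', cfc_congr (g := fun _ => 0) hp, cfc_const_zero]

/-- Entries of powers of the adjacency matrix vanish below the distance, so a monic polynomial in
the adjacency matrix agrees with the top power at pairs at distance equal to the degree. -/
theorem SimpleGraph.aeval_adjMatrix_apply_of_dist_eq_natDegree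
    {V : Type*} [Fintype V] [DecidableEq V] (G : SimpleGraph V) [DecidableRel G.Adj]
    {R : Type*} [CommRing R] {p : R[X]} (hp : p.Monic) {u v : V}
    (huv : G.dist u v = p.natDegree) :
    aeval (G.adjMatrix R) p u v = (G.adjMatrix R ^ p.natDegree) u v := by
  rw [aeval_eq_sum_range, Finset.sum_range_succ, Matrix.add_apply, Matrix.sum_apply,
    Finset.sum_eq_zero, hp.coeff_natDegree, one_smul, zero_add]
  intro k hk
  have hempty : IsEmpty {w : G.Walk u v | w.length = k} := by
    refine ⟨fun w => ?_⟩
    have hle := G.dist_le w.1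
    have hlen : w.1.length = k := w.2
    have := Finset.mem_range.mp hk
    omega
  rw [Matrix.smul_apply, G.adjMatrix_pow_apply_eq_card_walk, Fintype.card_eq_zero, Nat.cast_zero,
    smul_zero]

/-- For a connected regular graph, the eigenspace of the valency consists of constant vectors. -/
theorem SimpleGraph.Connected.eq_of_adjMatrix_mulVec_eq_smul
    {V : Type*} [Fintype V] [DecidableEq V] {G : SimpleGraph V} [DecidableRel G.Adj]
    (hconn : G.Connected) {δ : ℕ} (hreg : G.IsRegularOfDegree δ) {x : V → ℝ}
    (hx : Matrix.mulVec (G.adjMatrix ℝ) x = (δ : ℝ) • x) (u v : V) : x u = x v := by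
  refine (G.lapMatrix_mulVec_eq_zero_iff_forall_reachable (x := x)).mp ?_ u v (hconn u v)
  ext w
  simp [SimpleGraph.lapMatrix, SimpleGraph.degMatrix, Matrix.sub_mulVec, Matrix.mulVec_diagonal,
    hx, hreg w]

theorem Matrix.vecMul_aeval_of_vecMul_eq_smul
    {V R : Type*} [Fintype V] [DecidableEq V] [CommRing R] {A : Matrix V V R} {x : V → R} {c : R}
    (hx : Matrix.vecMul x A = c • x) (p : R[X]) :
    Matrix.vecMul x (aeval A p) = p.eval c • x := by
  induction p using Polynomial.induction_on' with
  | add p q hp hq => rw [map_add, Matrix.vecMul_add, hp, hq, eval_add, add_smul]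
  | monomial k a =>
    have hpow : Matrix.vecMul x (A ^ k) = c ^ k • x := by
      induction k with
      | zero => simp
      | succ k ih => rw [pow_succ, ← Matrix.vecMul_vecMul, ih, Matrix.smul_vecMul, hx, smul_smul,
          pow_succ]
    rw [aeval_monomial, eval_monomial, ← Algebra.smul_def, Matrix.vecMul_smul, hpow, smul_smul]

/-- In a connected `δ`-regular graph on `n` vertices with `d + 1`
distinct eigenvalues `θ 0 = δ > θ 1 > ⋯ > θ d` and diameter `d`, the number of walks of
length `d` between any two vertices at distance `d` equals `π₀ / n`, where
`π₀ = ∏_{i=1}^{d} (δ − θ i)`. -/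
theorem walkCount_at_diameter
    {V : Type*} [Fintype V] [DecidableEq V]
    (G : SimpleGraph V) [DecidableRel G.Adj] (hconn : G.Connected)
    (δ : ℕ) (hreg : G.IsRegularOfDegree δ)
    (d : ℕ) (θ : Fin (d + 1) → ℝ) (hθ : StrictAnti θ)
    (hspec : spectrum ℝ (G.adjMatrix ℝ) = Set.range θ)
    (hθ0 : θ 0 = (δ : ℝ))
    (hdiam : (∀ u v : V, G.dist u v ≤ d) ∧ ∃ u v : V, G.dist u v = d) :
    ∀ u v : V, G.dist u v = d →
      ((G.adjMatrix ℝ) ^ d) u v =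
        (∏ i : Fin d, ((δ : ℝ) - θ i.succ)) / (Fintype.card V : ℝ) := by
  intro u v huv
  set A := G.adjMatrix ℝ with hA
  set P : ℝ[X] := ∏ i : Fin d, (X - C (θ i.succ)) with hP
  have hmonic : P.Monic := monic_prod_X_sub_C _ _
  have hdeg : P.natDegree = d := by simp [hP]
  have heval : P.eval (δ : ℝ) = ∏ i : Fin d, ((δ : ℝ) - θ i.succ) := by
    simp [hP, eval_prod]
  have hherm : A.IsHermitian := by
    rw [Matrix.IsHermitian, Matrix.conjTranspose_eq_transpose_of_trivial]
    exact G.transpose_adjMatrix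
  have hann : aeval A ((X - C (δ : ℝ)) * P) = 0 := by
    refine hherm.aeval_eq_zero_of_forall_mem_spectrum _ fun x hx => ?_
    rw [hspec] at hx
    obtain ⟨i, rfl⟩ := hx
    rw [← hθ0, hP, ← Fin.prod_univ_succ fun i => X - C (θ i), eval_prod]
    exact Finset.prod_eq_zero (Finset.mem_univ i) (by simp)
  have hAH : A * aeval A P = (δ : ℝ) • aeval A P := by
    rw [map_mul, map_sub, aeval_X, aeval_C, sub_mul, ← Algebra.smul_def] at hann
    exact sub_eq_zero.mp hann
  have hcol (w : V) : aeval A P w v = aeval A P u v :=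
    hconn.eq_of_adjMatrix_mulVec_eq_smul hreg (x := fun w => aeval A P w v)
      (funext fun w => congr_fun (congr_fun hAH w) v) w u
  have hone : Matrix.vecMul (1 : V → ℝ) A = (δ : ℝ) • (1 : V → ℝ) := by
    ext w
    simp [hA, hreg w]
  have hsum := congr_fun (Matrix.vecMul_aeval_of_vecMul_eq_smul hone P) v
  have hcard : (Fintype.card V : ℝ) ≠ 0 := by
    have : Nonempty V := ⟨u⟩
    exact_mod_cast Fintype.card_ne_zero
  have htop := G.aeval_adjMatrix_apply_of_dist_eq_natDegree hmonic (huv.trans hdeg.symm)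
  rw [hdeg] at htop
  rw [eq_div_iff hcard, ← heval, ← htop, mul_comm]
  simpa [Matrix.vecMul, dotProduct, hcol] using hsum
end
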